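/- In the CQ setting described in the context, lim_{n→∞} d(x_n, x_{n+1}) = 0. -/

import Mathlib

open Filter Topology

noncomputable section

open scoped Classical

/-- The spherical metric on the unit sphere of a real Hilbert space:
`d(x,y) = arccos ⟨x,y⟩`. -/
def sphDist {H : Type*} [NormedAddCommGroup H] [InnerProductSpace ℝ H]
    (x y : H) : ℝ :=
  Real.arccos (@inner ℝ H _ x y)

/-- The geodesic combination `t x ⊕ (1-t) y` on the unit sphere:
for `x ≠ y` it is `(sin(tθ)/sin θ) • x + (sin((1-t)θ)/sin θ) • y` with `θ = d(x,y)`,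
and `t x ⊕ (1-t) x = x`. -/
def geo {H : Type*} [NormedAddCommGroup H] [InnerProductSpace ℝ H]
    (t : ℝ) (x y : H) : H :=
  if x = y then x
  else (Real.sin (t * sphDist x y) / Real.sin (sphDist x y)) • x +
    (Real.sin ((1 - t) * sphDist x y) / Real.sin (sphDist x y)) • y

/-- Convexity of a subset of the unit sphere with respect to geodesic combinations. -/
def SphConvex {H : Type*} [NormedAddCommGroup H] [InnerProductSpace ℝ H]
    (C : Set H) : Prop :=
  ∀ v ∈ C, ∀ v' ∈ C, ∀ t ∈ Set.Icc (0 : ℝ) 1, geo t v v' ∈ C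

/-- The mappings `U_i` generating the `W`-mapping: `U_0 = I`,
`U_i x = α_i (T_i (U_{i-1} x)) ⊕ (1 - α_i) x`.  The `W`-mapping generated by
`T_1, …, T_r` and `α_1, …, α_r` is `W = Uiter T α r`. -/
def Uiter {H : Type*} [NormedAddCommGroup H] [InnerProductSpace ℝ H]
    (T : ℕ → H → H) (α : ℕ → ℝ) : ℕ → H → H
  | 0 => id
  | (i + 1) => fun x => geo (α (i + 1)) (T (i + 1) (Uiter T α i x)) x

lemma cos_sphDist {H : Type*} [NormedAddCommGroup H] [InnerProductSpace ℝ H]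
    {u v : H} (hu : ‖u‖ = 1) (hv : ‖v‖ = 1) :
    Real.cos (sphDist u v) = inner ℝ u v := by
  have h := abs_le.mp (abs_real_inner_le_norm u v)
  rw [hu, hv] at h
  unfold sphDist
  exact Real.cos_arccos (by linarith [h.1]) (by linarith [h.2])

lemma sphDist_le_iff {H : Type*} [NormedAddCommGroup H] [InnerProductSpace ℝ H]
    {u v u' v' : H} (hu : ‖u‖ = 1) (hv : ‖v‖ = 1) (hu' : ‖u'‖ = 1) (hv' : ‖v'‖ = 1) :
    sphDist u v ≤ sphDist u' v' ↔ (inner ℝ u' v' : ℝ) ≤ inner ℝ u v := by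
  constructor
  · intro h
    rw [← cos_sphDist hu hv, ← cos_sphDist hu' hv']
    exact Real.cos_le_cos_of_nonneg_of_le_pi (Real.arccos_nonneg _) (Real.arccos_le_pi _) h
  · intro h
    exact Real.antitone_arccos h

lemma sphDist_pos_of_ne {H : Type*} [NormedAddCommGroup H] [InnerProductSpace ℝ H]
    {u v : H} (hu : ‖u‖ = 1) (hv : ‖v‖ = 1) (hne : u ≠ v) : 0 < sphDist u v := by
  unfold sphDist
  rw [Real.arccos_pos]
  exact (inner_lt_one_iff_real_of_norm_eq_one hu hv).mpr hne

/-- The geodesic combination is a nonnegative combination with total weight at least one. -/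
lemma geo_coeff {H : Type*} [NormedAddCommGroup H] [InnerProductSpace ℝ H]
    {u v : H} (hu : ‖u‖ = 1) (hv : ‖v‖ = 1) (hd : sphDist u v < Real.pi / 2)
    {t : ℝ} (ht : t ∈ Set.Icc (0 : ℝ) 1) :
    ∃ p q : ℝ, 0 ≤ p ∧ 0 ≤ q ∧ 1 ≤ p + q ∧ geo t u v = p • u + q • v := by
  unfold geo
  split_ifs with h
  · exact ⟨1, 0, by norm_num, by norm_num, by norm_num, by simp⟩
  · have hpos := sphDist_pos_of_ne hu hv h
    set θ := sphDist u v with hθ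
    have hs : 0 < Real.sin θ := Real.sin_pos_of_pos_of_lt_pi hpos (by linarith [Real.pi_pos])
    obtain ⟨h0, h1⟩ := ht
    have a1 : 0 ≤ Real.sin (t * θ) :=
      Real.sin_nonneg_of_nonneg_of_le_pi (by positivity) (by nlinarith [Real.pi_pos])
    have a2 : 0 ≤ Real.sin ((1 - t) * θ) :=
      Real.sin_nonneg_of_nonneg_of_le_pi (mul_nonneg (by linarith) hpos.le)
        (by nlinarith [Real.pi_pos])
    refine ⟨_, _, div_nonneg a1 hs.le, div_nonneg a2 hs.le, ?_, rfl⟩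
    rw [← add_div, le_div_iff₀ hs, one_mul]
    have e : Real.sin θ = Real.sin (t * θ) * Real.cos ((1 - t) * θ)
        + Real.cos (t * θ) * Real.sin ((1 - t) * θ) := by
      rw [← Real.sin_add]; congr 1; ring
    rw [e]
    nlinarith [Real.cos_le_one (t * θ), Real.cos_le_one ((1 - t) * θ)]

/-- First-order optimality: if `p` maximizes `⟨w, ·⟩` on the geodesic from `p` to `z`. -/
lemma opt_cond {H : Type*} [NormedAddCommGroup H] [InnerProductSpace ℝ H]
    {w z p : H} (hz : ‖z‖ = 1) (hp : ‖p‖ = 1) (hd : sphDist z p < Real.pi / 2)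
    (hopt : ∀ t ∈ Set.Icc (0 : ℝ) 1, (inner ℝ w (geo t z p) : ℝ) ≤ inner ℝ w p) :
    (inner ℝ w z : ℝ) ≤ inner ℝ w p * inner ℝ p z := by
  by_cases hne : z = p
  · subst hne
    rw [real_inner_self_eq_norm_sq, hz]; simp
  have hpos := sphDist_pos_of_ne hz hp hne
  have hc : Real.cos (sphDist z p) = inner ℝ p z := by
    rw [cos_sphDist hz hp, real_inner_comm]
  rw [← hc]
  set θ := sphDist z p with hθ
  have hs : 0 < Real.sin θ := Real.sin_pos_of_pos_of_lt_pi hpos (by linarith [Real.pi_pos])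
  set A : ℝ := inner ℝ w z
  set B : ℝ := inner ℝ w p
  have key : ∀ h : ℝ, 0 < h → h < θ / 2 →
      Real.cos h * A ≤ B * (Real.sin θ * Real.sin h + Real.cos θ * Real.cos h) := by
    intro h h0 h1
    have := hopt (2 * h / θ) ⟨by positivity, by rw [div_le_one hpos]; linarith⟩
    unfold geo at this
    rw [if_neg hne, ← hθ, inner_add_right, inner_smul_right, inner_smul_right] at this
    have e1 : 2 * h / θ * θ = 2 * h := by field_simp
    have e2 : (1 - 2 * h / θ) * θ = θ - 2 * h := by field_simp
    rw [e1, e2] at this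
    change _ * A + _ * B ≤ B at this
    have h2 : Real.sin (2 * h) * A + Real.sin (θ - 2 * h) * B ≤ B * Real.sin θ := by
      have := mul_le_mul_of_nonneg_right this hs.le
      calc _ = (Real.sin (2 * h) / Real.sin θ * A + Real.sin (θ - 2 * h) / Real.sin θ * B)
            * Real.sin θ := by field_simp
        _ ≤ _ := this
    rw [Real.sin_sub, Real.sin_two_mul, Real.cos_two_mul'] at h2
    have hsh : 0 < Real.sin h := Real.sin_pos_of_pos_of_lt_pi h0 (by linarith [Real.pi_pos])
    have hsq := Real.sin_sq_add_cos_sq h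
    have hsq' : Real.cos h ^ 2 = 1 - Real.sin h ^ 2 := by linarith
    rw [hsq'] at h2
    refine le_of_mul_le_mul_left ?_ hsh
    linarith
  have l1 : Tendsto (fun h : ℝ => Real.cos h * A) (𝓝[>] 0) (𝓝 A) := by
    have : Continuous (fun h : ℝ => Real.cos h * A) := by fun_prop
    have := (this.tendsto 0).mono_left (nhdsWithin_le_nhds (s := Set.Ioi 0))
    simpa using this
  have l2 : Tendsto (fun h : ℝ => B * (Real.sin θ * Real.sin h + Real.cos θ * Real.cos h))
      (𝓝[>] 0) (𝓝 (B * Real.cos θ)) := by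
    have : Continuous (fun h : ℝ =>
      B * (Real.sin θ * Real.sin h + Real.cos θ * Real.cos h)) := by fun_prop
    have := (this.tendsto 0).mono_left (nhdsWithin_le_nhds (s := Set.Ioi 0))
    simpa using this
  refine le_of_tendsto_of_tendsto l1 l2 ?_
  filter_upwards [Ioo_mem_nhdsGT (show (0 : ℝ) < θ / 2 by linarith)] with h hh
  exact key h hh.1 hh.2

/-- In the CQ setting, `lim_{n→∞} d(x_n, x_{n+1}) = 0`. -/
theorem cq_consecutive_distances_tendsto_zero
    {H : Type*} [NormedAddCommGroup H] [InnerProductSpace ℝ H]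
    -- `C` is a nonempty closed convex subset of the unit sphere `S_H`
    (C : Set H) (hCsphere : ∀ v ∈ C, ‖v‖ = 1)
    (hCne : C.Nonempty) (hCclosed : IsClosed C) (hCconv : SphConvex C)
    (hCdiam : ∀ v ∈ C, ∀ v' ∈ C, sphDist v v' < Real.pi / 2)
    (a : ℝ) (ha0 : 0 < a) (ha1 : a < 1 / 2)
    (r : ℕ) (hr : 1 ≤ r)
    (α : ℕ → ℕ → ℝ)
    (hα : ∀ n, 1 ≤ n → ∀ i, 1 ≤ i → i ≤ r → α n i ∈ Set.Icc a (1 - a))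
    -- `T_1, …, T_r` are nonexpansive self-mappings of `C`
    (T : ℕ → H → H)
    (hTmaps : ∀ i, 1 ≤ i → i ≤ r → ∀ v ∈ C, T i v ∈ C)
    (hTnonexp : ∀ i, 1 ≤ i → i ≤ r → ∀ v ∈ C, ∀ v' ∈ C,
      sphDist (T i v) (T i v') ≤ sphDist v v')
    -- `F := ⋂ᵢ F(Tᵢ) ≠ ∅`
    (F : Set H)
    (hF : F = ⋂ i ∈ Finset.Icc 1 r, {z ∈ C | T i z = z})
    (hFne : F.Nonempty)
    -- the CQ iteration: `y_n = W_n x_n`, `x_{n+1} = P_{C_n ∩ Q_n} x_1`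
    (x y : ℕ → H) (hx1 : x 1 ∈ C)
    (hy : ∀ n, y n = Uiter T (α n) r (x n))
    (CS QS : ℕ → Set H)
    (hCS : ∀ n, CS n = {z ∈ C | sphDist (y n) z ≤ sphDist (x n) z})
    (hQS : ∀ n, QS n = {z ∈ C |
      Real.cos (sphDist (x 1) z) ≤
        Real.cos (sphDist (x 1) (x n)) * Real.cos (sphDist (x n) z)})
    (hxmem : ∀ n, 1 ≤ n → x (n + 1) ∈ CS n ∩ QS n)
    (hxproj : ∀ n, 1 ≤ n → ∀ z ∈ CS n ∩ QS n,
      sphDist (x 1) (x (n + 1)) ≤ sphDist (x 1) z)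
    :
    Tendsto (fun n => sphDist (x n) (x (n + 1))) atTop (𝓝 0) := by
  have hα' : ∀ n, 1 ≤ n → ∀ i, 1 ≤ i → i ≤ r → α n i ∈ Set.Icc (0 : ℝ) 1 := by
    intro n hn i hi hir
    have h := hα n hn i hi hir
    exact ⟨by linarith [h.1], by linarith [h.2]⟩
  have hpos : ∀ u ∈ C, ∀ v ∈ C, (0 : ℝ) < inner ℝ u v := by
    intro u hu v hv
    have h := hCdiam u hu v hv
    unfold sphDist at h
    exact Real.arccos_lt_pi_div_two.mp h
  have hxC : ∀ n, 1 ≤ n → x n ∈ C := by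
    intro n hn
    rcases Nat.lt_or_ge 1 n with h | h
    · obtain ⟨m, rfl⟩ : ∃ m, n = m + 1 := ⟨n - 1, by omega⟩
      have := (hxmem m (by omega)).1
      rw [hCS] at this
      exact this.1
    · have : n = 1 := by omega
      rw [this]; exact hx1
  obtain ⟨z, hz⟩ := hFne
  rw [hF] at hz
  simp only [Set.mem_iInter, Finset.mem_Icc, Set.mem_setOf_eq] at hz
  have hzC : z ∈ C := (hz 1 ⟨le_refl _, hr⟩).1
  have hzT : ∀ i, 1 ≤ i → i ≤ r → T i z = z := fun i h1 h2 => (hz i ⟨h1, h2⟩).2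
  have hz1 := hCsphere z hzC
  -- quasi-nonexpansiveness of the `U_i`
  have hU : ∀ n, 1 ≤ n → ∀ i, i ≤ r → Uiter T (α n) i (x n) ∈ C ∧
      (inner ℝ (x n) z : ℝ) ≤ inner ℝ (Uiter T (α n) i (x n)) z := by
    intro n hn i
    induction i with
    | zero => intro _; exact ⟨hxC n hn, le_refl _⟩
    | succ i ih =>
      intro hi
      obtain ⟨h1, h2⟩ := ih (by omega)
      have hTC := hTmaps (i + 1) (by omega) hi _ h1
      have hne := hTnonexp (i + 1) (by omega) hi _ h1 z hzC
      rw [hzT (i + 1) (by omega) hi, sphDist_le_iff (hCsphere _ hTC) hz1 (hCsphere _ h1) hz1] at hne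
      have ht := hα' n hn (i + 1) (by omega) hi
      refine ⟨hCconv _ hTC _ (hxC n hn) _ ht, ?_⟩
      obtain ⟨p, q, hp, hq, hpq, e⟩ := geo_coeff (hCsphere _ hTC) (hCsphere _ (hxC n hn))
        (hCdiam _ hTC _ (hxC n hn)) ht
      change _ ≤ inner ℝ (geo (α n (i + 1)) (T (i + 1) (Uiter T (α n) i (x n))) (x n)) z
      rw [e, inner_add_left, real_inner_smul_left, real_inner_smul_left]
      have hxz := hpos _ (hxC n hn) z hzC
      have := mul_le_mul_of_nonneg_left (h2.trans hne) hp
      nlinarith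
  have hyC : ∀ n, 1 ≤ n → y n ∈ C := fun n hn => by
    rw [hy]; exact (hU n hn r le_rfl).1
  have memCS : ∀ n, 1 ≤ n → ∀ v, v ∈ CS n ↔ v ∈ C ∧ (inner ℝ (x n) v : ℝ) ≤ inner ℝ (y n) v := by
    intro n hn v
    rw [hCS]
    refine and_congr_right fun hv => ?_
    exact sphDist_le_iff (hCsphere _ (hyC n hn)) (hCsphere _ hv) (hCsphere _ (hxC n hn))
      (hCsphere _ hv)
  have memQS : ∀ n, 1 ≤ n → ∀ v, v ∈ QS n ↔ v ∈ C ∧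
      (inner ℝ (x 1) v : ℝ) ≤ inner ℝ (x 1) (x n) * inner ℝ (x n) v := by
    intro n hn v
    rw [hQS]
    refine and_congr_right fun hv => ?_
    rw [cos_sphDist (hCsphere _ hx1) (hCsphere _ hv),
      cos_sphDist (hCsphere _ hx1) (hCsphere _ (hxC n hn)),
      cos_sphDist (hCsphere _ (hxC n hn)) (hCsphere _ hv)]
  have hzCS : ∀ n, 1 ≤ n → z ∈ CS n := by
    intro n hn
    rw [memCS n hn, hy]
    exact ⟨hzC, (hU n hn r le_rfl).2⟩
  have hzQS : ∀ n, 1 ≤ n → z ∈ QS n := by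
    intro n hn
    induction n, hn using Nat.le_induction with
    | base =>
      rw [memQS 1 le_rfl]
      refine ⟨hzC, ?_⟩
      rw [real_inner_self_eq_norm_sq, hCsphere _ hx1]; simp
    | succ n hn ih =>
      rw [memQS (n + 1) (by omega)]
      refine ⟨hzC, ?_⟩
      have hpC := hxC (n + 1) (by omega)
      refine opt_cond hz1 (hCsphere _ hpC) (hCdiam _ hzC _ hpC) ?_
      intro t ht
      have hgC := hCconv _ hzC _ hpC _ ht
      obtain ⟨p, q, hp, hq, hpq, e⟩ := geo_coeff hz1 (hCsphere _ hpC) (hCdiam _ hzC _ hpC) ht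
      rw [← sphDist_le_iff (hCsphere _ hx1) (hCsphere _ hpC) (hCsphere _ hx1) (hCsphere _ hgC)]
      apply hxproj n hn
      have a1 := ((memCS n hn _).mp (hzCS n hn)).2
      have a2 := ((memQS n hn _).mp ih).2
      have b1 := ((memCS n hn _).mp (hxmem n hn).1).2
      have b2 := ((memQS n hn _).mp (hxmem n hn).2).2
      constructor
      · rw [memCS n hn]
        refine ⟨hgC, ?_⟩
        rw [e]
        simp only [inner_add_right, inner_smul_right]
        exact add_le_add (mul_le_mul_of_nonneg_left a1 hp) (mul_le_mul_of_nonneg_left b1 hq)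
      · rw [memQS n hn]
        refine ⟨hgC, ?_⟩
        rw [e]
        simp only [inner_add_right, inner_smul_right]
        have := mul_le_mul_of_nonneg_left a2 hp
        have := mul_le_mul_of_nonneg_left b2 hq
        linarith
  -- the sequence of cosines
  rw [← tendsto_add_atTop_iff_nat 1]
  set c : ℕ → ℝ := fun n => inner ℝ (x 1) (x (n + 1)) with hc
  have hcpos : ∀ n, 0 < c n := fun n => hpos _ hx1 _ (hxC (n + 1) (by omega))
  have hin : ∀ n, (inner ℝ (x (n + 1)) (x (n + 1 + 1)) : ℝ) ≤ 1 := by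
    intro n
    have := real_inner_le_norm (x (n + 1)) (x (n + 1 + 1))
    rwa [hCsphere _ (hxC (n + 1) (by omega)), hCsphere _ (hxC (n + 1 + 1) (by omega)),
      one_mul] at this
  have hstep : ∀ n, c (n + 1) ≤ c n * inner ℝ (x (n + 1)) (x (n + 1 + 1)) := fun n =>
    ((memQS (n + 1) (by omega) _).mp (hxmem (n + 1) (by omega)).2).2
  have hanti : Antitone c := antitone_nat_of_succ_le fun n => by
    have := mul_le_mul_of_nonneg_left (hin n) (hcpos n).le
    linarith [hstep n]
  have hδ : ∀ n, (inner ℝ (x 1) z : ℝ) ≤ c (n + 1) := by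
    intro n
    have := hxproj (n + 1) (by omega) z ⟨hzCS _ (by omega), hzQS _ (by omega)⟩
    rwa [sphDist_le_iff (hCsphere _ hx1) (hCsphere _ (hxC (n + 1 + 1) (by omega)))
      (hCsphere _ hx1) hz1] at this
  have hbdd : BddBelow (Set.range c) := ⟨0, by rintro _ ⟨n, rfl⟩; exact (hcpos n).le⟩
  have hlim := tendsto_atTop_ciInf hanti hbdd
  set L := ⨅ n, c n
  have hlim1 := (tendsto_add_atTop_iff_nat 1).mpr hlim
  have hL : 0 < L := lt_of_lt_of_le (hpos _ hx1 _ hzC) (ge_of_tendsto' hlim1 hδ)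
  have hratio : Tendsto (fun n => c (n + 1) / c n) atTop (𝓝 1) := by
    have := hlim1.div hlim hL.ne'
    rwa [div_self hL.ne'] at this
  have hinner : Tendsto (fun n => (inner ℝ (x (n + 1)) (x (n + 1 + 1)) : ℝ)) atTop (𝓝 1) := by
    refine tendsto_of_tendsto_of_tendsto_of_le_of_le hratio tendsto_const_nhds (fun n => ?_) hin
    change c (n + 1) / c n ≤ _
    rw [div_le_iff₀ (hcpos n), mul_comm]
    exact hstep n
  have := (Real.continuous_arccos.tendsto 1).comp hinner
  rw [Real.arccos_one] at this
  exact this
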